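/- arXiv:1002.4995 — 2 statements merged into one kernel-verified Lean document; each statement's English description precedes it below -/
import Mathlib

section
/- Let d ≥ 2, L₀ ≥ 1, G ≥ 1, and let U₁,…,U_G ⊆ ℤ^d be finite connected sets; set 𝒪_i = fill(U_i) for i = 1,…,G. Assume: (i) χ(𝒪_i) = 0 for all i; (ii) d_∞(U_i,U_j) > 1 for all 1 ≤ i < j ≤ G; (iii) each 𝒪_i is (L₀/(2G))-avoidable in C³. Then χ(⋃_{i=1}^G 𝒪_i) = 0. -/
/-- Points of `ℤ^d`. -/
abbrev Pt (d : ℕ) := Fin d → ℤ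

namespace RI

variable {d : ℕ}

/-- `l¹` distance between two points (ℕ-valued). -/
def n1 (x y : Pt d) : ℕ := ∑ j, (x j - y j).natAbs

/-- `l∞` distance between two points (ℕ-valued). -/
def ninf (x y : Pt d) : ℕ := Finset.univ.sup fun j => (x j - y j).natAbs

/-- nearest-neighbor adjacency: `‖x - y‖₁ = 1` -/
def adj (x y : Pt d) : Prop := n1 x y = 1

/-- `*`-adjacency: `‖x - y‖_∞ = 1` -/
def adjStar (x y : Pt d) : Prop := ninf x y = 1

/-- `τ` is a nearest-neighbor path of length `N`. -/
def IsPath (τ : ℕ → Pt d) (N : ℕ) : Prop := ∀ l < N, adj (τ l) (τ (l + 1))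

/-- the range of a path of length `N` -/
def pathRange (τ : ℕ → Pt d) (N : ℕ) : Set (Pt d) := τ '' {l | l ≤ N}

/-- `x` and `y` are joined by a nearest-neighbor path all of whose points lie in `U`. -/
def ConnIn (U : Set (Pt d)) (x y : Pt d) : Prop :=
  ∃ τ N, IsPath τ N ∧ τ 0 = x ∧ τ N = y ∧ ∀ l ≤ N, τ l ∈ U

/-- a set is connected: any two of its points are joined by a path inside it -/
def ConnSet (A : Set (Pt d)) : Prop := ∀ x ∈ A, ∀ y ∈ A, ConnIn A x y

/-- the connected component of `U` containing `x` -/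
def comp (U : Set (Pt d)) (x : Pt d) : Set (Pt d) := {y | ConnIn U x y}

/-- the (outer) boundary `∂K` -/
def bd (K : Set (Pt d)) : Set (Pt d) := {x | x ∉ K ∧ ∃ y ∈ K, adj x y}

/-- the `*`-boundary `∂*K` -/
def bdStar (K : Set (Pt d)) : Set (Pt d) := {x | x ∉ K ∧ ∃ y ∈ K, adjStar x y}

/-- the interior boundary `∂_int K` -/
def intBd (K : Set (Pt d)) : Set (Pt d) := {x | x ∈ K ∧ ∃ y, y ∉ K ∧ adj x y}

/-- the `l∞` diameter of a set, valued in `ℕ∞` -/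
noncomputable def diam (K : Set (Pt d)) : ℕ∞ := ⨆ x ∈ K, ⨆ y ∈ K, (ninf x y : ℕ∞)

/-- the `l¹` distance between `K` and `K'` exceeds `1` -/
def far1 (K K' : Set (Pt d)) : Prop := ∀ x ∈ K, ∀ y ∈ K', 1 < n1 x y

/-- the `l∞` distance between `K` and `K'` exceeds `1` -/
def farInf (K K' : Set (Pt d)) : Prop := ∀ x ∈ K, ∀ y ∈ K', 1 < ninf x y

/-- `d_∞(K, K') ≤ r` -/
def dInfLE (K K' : Set (Pt d)) (r : ℕ) : Prop := ∃ x ∈ K, ∃ y ∈ K', ninf x y ≤ r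

/-- `fill A`: the set of points every connected set around which inside `Aᶜ` is finite;
for `d ≥ 2` and finite `A` this is exactly the complement of the unique infinite
connected component of `Aᶜ`. -/
def fill (A : Set (Pt d)) : Set (Pt d) :=
  {z | ∀ S : Set (Pt d), z ∈ S → S ⊆ Aᶜ → ConnSet S → S.Finite}

/-- `A₁` and `A₂` are separated by `𝒰` in `B`: `d(A₁,A₂) > 1` and every path in `B`
joining `∂A₁` to `∂A₂` meets `𝒰`. -/
def SeparatedBy (A₁ A₂ 𝒰 B : Set (Pt d)) : Prop :=
  far1 A₁ A₂ ∧
  ∀ τ N, IsPath τ N → (∀ l ≤ N, τ l ∈ B) → τ 0 ∈ bd A₁ → τ N ∈ bd A₂ →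
    ∃ l ≤ N, τ l ∈ 𝒰

/-- the scales `L_κ = L₀ (80 L)^κ` -/
def Lscale (L L₀ κ : ℕ) : ℕ := L₀ * (80 * L) ^ κ

/-- the box `C_{(κ,i)} = (i L_κ + [0, L_κ)^d) ∩ ℤ^d` -/
def boxC (L L₀ κ : ℕ) (i : Pt d) : Set (Pt d) :=
  {x | ∀ j, i j * (Lscale L L₀ κ : ℤ) ≤ x j ∧
    x j < i j * (Lscale L L₀ κ : ℤ) + (Lscale L L₀ κ : ℤ)}

/-- the neighborhood `C_{(κ,i)}^l = ⋃_{‖j‖_∞ < l} C_{(κ, i+j)}` -/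
def boxCl (L L₀ κ : ℕ) (i : Pt d) (l : ℕ) : Set (Pt d) :=
  ⋃ j ∈ {j : Pt d | ∀ t, (j t).natAbs < l}, boxC L L₀ κ (i + j)

/-- the separation event `χ_{(κ,i)}(𝒰) = 1`: there are connected sets
`A₁, A₂ ⊆ C_{(κ,i)}^2` of diameter at least `L_κ / 2` separated by `𝒰` in `C_{(κ,i)}^3` -/
def chi (L L₀ κ : ℕ) (i : Pt d) (𝒰 : Set (Pt d)) : Prop :=
  ∃ A₁ A₂ : Set (Pt d), A₁ ⊆ boxCl L L₀ κ i 2 ∧ A₂ ⊆ boxCl L L₀ κ i 2 ∧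
    ConnSet A₁ ∧ ConnSet A₂ ∧
    (Lscale L L₀ κ : ℕ∞) ≤ 2 * diam A₁ ∧ (Lscale L L₀ κ : ℕ∞) ≤ 2 * diam A₂ ∧
    SeparatedBy A₁ A₂ 𝒰 (boxCl L L₀ κ i 3)

/-- the centered boxes `C^l = [-(l-1)L₀, l L₀)^d ∩ ℤ^d` -/
def boxCen (L₀ l : ℕ) : Set (Pt d) :=
  {x | ∀ j, -(((l : ℤ) - 1) * (L₀ : ℤ)) ≤ x j ∧ x j < (l : ℤ) * (L₀ : ℤ)}

/-- the separation event `χ(𝒰) = 1` for the centered boxes -/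
def chi0 (L₀ : ℕ) (𝒰 : Set (Pt d)) : Prop :=
  ∃ A₁ A₂ : Set (Pt d), A₁ ⊆ boxCen L₀ 2 ∧ A₂ ⊆ boxCen L₀ 2 ∧
    ConnSet A₁ ∧ ConnSet A₂ ∧
    (L₀ : ℕ∞) ≤ 2 * diam A₁ ∧ (L₀ : ℕ∞) ≤ 2 * diam A₂ ∧
    SeparatedBy A₁ A₂ 𝒰 (boxCen L₀ 3)

/-- `A` is `h`-avoidable in `C`: every path in `C` with endpoints outside `A` can be
modified, within `l∞` distance `h` of its range and through `Range(τ) ∪ ∂*A`,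
into a path with the same endpoints avoiding `A`. -/
def Avoidable (h : ℝ) (A C : Set (Pt d)) : Prop :=
  ∀ τ N, IsPath τ N → (∀ l ≤ N, τ l ∈ C) → τ 0 ∉ A → τ N ∉ A →
    ∃ τ' N', IsPath τ' N' ∧ τ' 0 = τ 0 ∧ τ' N' = τ N ∧
      (∀ l ≤ N', τ' l ∉ A) ∧
      (∀ l ≤ N', (∃ k ≤ N, (ninf (τ' l) (τ k) : ℝ) ≤ h) ∧
        (τ' l ∈ pathRange τ N ∨ τ' l ∈ bdStar A))

/-- a doubly infinite transient nearest-neighbor trajectory -/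
def IsTraj (w : ℤ → Pt d) : Prop :=
  (∀ l : ℤ, adj (w l) (w (l + 1))) ∧
  Filter.Tendsto (fun l : ℤ => n1 (w l) 0) Filter.cofinite Filter.atTop

/-- `k` is a cut-time of `w`: `d_∞({w(l) : l < k}, {w(l) : l > k}) > 1` -/
def CutTime (w : ℤ → Pt d) (k : ℤ) : Prop :=
  ∀ l, l < k → ∀ l', k < l' → 1 < ninf (w l) (w l')

/-- the `j`-th sausage `𝒰_j = {w(l) : n_j < l < n_{j+1}}` -/
def sausage (w : ℤ → Pt d) (n : ℕ → ℤ) (j : ℕ) : Set (Pt d) :=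
  w '' {l | n j < l ∧ l < n (j + 1)}

/-- boxes: products of integer intervals -/
def IsBox (B : Set (Pt d)) : Prop :=
  ∃ a b : Pt d, B = {x | ∀ j, a j ≤ x j ∧ x j ≤ b j}

/-- the smallest box containing `K` -/
def sbox (K : Set (Pt d)) : Set (Pt d) := ⋂₀ {B | IsBox B ∧ K ⊆ B}

/-- the closed `l∞` ball `B(x, r)` -/
def ball (x : Pt d) (r : ℕ) : Set (Pt d) := {y | ninf x y ≤ r}

/-- a skeleton: a set of indices at the finest scale satisfying the Wiener-type
spacing conditions -/
def IsSkeleton (L L₀ : ℕ) (M : Finset (Pt d)) : Prop :=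
  ∀ m₀ ∈ M,
    (∀ h : ℕ,
      {m : Pt d | m ∈ M ∧
        dInfLE (boxC L L₀ 0 m₀) (boxC L L₀ 0 m) (L * Lscale L L₀ (h + 1)) ∧
        ¬ dInfLE (boxC L L₀ 0 m₀) (boxC L L₀ 0 m) (L * Lscale L L₀ h)}.ncard
        ≤ 2 ^ (h + 1)) ∧
    ∀ m ∈ M, m ≠ m₀ → ¬ dInfLE (boxC L L₀ 0 m₀) (boxC L L₀ 0 m) (L * Lscale L L₀ 0)

section Adjacency

lemma n1_comm (x y : Pt d) : n1 x y = n1 y x :=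
  Finset.sum_congr rfl fun j _ => by omega

lemma ninf_le_iff {x y : Pt d} {r : ℕ} : ninf x y ≤ r ↔ ∀ j, (x j - y j).natAbs ≤ r := by
  simp [ninf]

lemma natAbs_sub_le_ninf (x y : Pt d) (j : Fin d) : (x j - y j).natAbs ≤ ninf x y :=
  ninf_le_iff.1 le_rfl j

lemma natAbs_sub_le_n1 (x y : Pt d) (j : Fin d) : (x j - y j).natAbs ≤ n1 x y :=
  Finset.single_le_sum (f := fun j => (x j - y j).natAbs) (fun _ _ => Nat.zero_le _)
    (Finset.mem_univ j)

lemma adj_comm {x y : Pt d} : adj x y ↔ adj y x := by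
  rw [adj, adj, n1_comm]

lemma adj_add_single (x : Pt d) (i : Fin d) {e : ℤ} (he : e.natAbs = 1) :
    adj x (x + Pi.single i e) := by
  unfold adj n1
  rw [Finset.sum_eq_single i] <;> simp +contextual [he]

lemma exists_single_of_adj {x y : Pt d} (h : adj x y) :
    ∃ i, y = x + Pi.single i 1 ∨ x = y + Pi.single i 1 := by
  have hne : ∃ i, x i ≠ y i := by
    by_contra! hc
    have : n1 x y = 0 := Finset.sum_eq_zero fun j _ => by simp [hc j]
    unfold adj at h
    omega
  obtain ⟨i, hi⟩ := hne
  have hsum := Finset.add_sum_erase Finset.univ (fun j => (x j - y j).natAbs) (Finset.mem_univ i)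
  have hn : ∑ j, (x j - y j).natAbs = 1 := h
  rw [hn] at hsum
  have hzero : ∑ j ∈ Finset.univ.erase i, (x j - y j).natAbs = 0 := by omega
  have heq : ∀ j, j ≠ i → x j = y j := fun j hj => by
    have := Finset.sum_eq_zero_iff.1 hzero j (by simp [hj])
    omega
  refine ⟨i, ?_⟩
  rcases (by omega : y i = x i + 1 ∨ x i = y i + 1) with h1 | h1
  · left
    funext j
    by_cases hj : j = i
    · subst hj; simp [h1]
    · simp [hj, heq j hj]
  · right
    funext j
    by_cases hj : j = i
    · subst hj; simp [h1]
    · simp [hj, heq j hj]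

end Adjacency

section Connectivity

lemma ConnIn.refl {U : Set (Pt d)} {x : Pt d} (hx : x ∈ U) : ConnIn U x x :=
  ⟨fun _ => x, 0, fun l hl => by omega, rfl, rfl, fun _ _ => hx⟩

lemma ConnIn.left_mem {U : Set (Pt d)} {x y : Pt d} (h : ConnIn U x y) : x ∈ U := by
  obtain ⟨τ, N, -, rfl, -, hU⟩ := h
  exact hU 0 (Nat.zero_le _)

lemma ConnIn.mono {U V : Set (Pt d)} {x y : Pt d} (h : ConnIn U x y) (hUV : U ⊆ V) :
    ConnIn V x y := by
  obtain ⟨τ, N, hp, h0, hN, hU⟩ := h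
  exact ⟨τ, N, hp, h0, hN, fun l hl => hUV (hU l hl)⟩

lemma ConnIn.tail {U : Set (Pt d)} {x y z : Pt d} (h : ConnIn U x y) (hyz : adj y z)
    (hz : z ∈ U) : ConnIn U x z := by
  obtain ⟨τ, N, hp, h0, hN, hU⟩ := h
  refine ⟨fun l => if l ≤ N then τ l else z, N + 1, fun l hl => ?_, by simpa, by simp,
    fun l hl => ?_⟩
  · rcases Nat.lt_succ_iff_lt_or_eq.1 hl with h1 | rfl
    · have h2 : l + 1 ≤ N := h1
      simpa [h1.le, h2] using hp l h1
    · simpa [hN] using hyz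
  · by_cases h1 : l ≤ N
    · simpa [h1] using hU l h1
    · simpa [h1] using hz

lemma ConnIn.induction {U : Set (Pt d)} {x y : Pt d} (h : ConnIn U x y) {P : Pt d → Prop}
    (hx : P x) (step : ∀ a b, a ∈ U → b ∈ U → adj a b → P a → P b) : P y := by
  obtain ⟨τ, N, hp, rfl, rfl, hU⟩ := h
  have key : ∀ l ≤ N, P (τ l) := by
    intro l
    induction l with
    | zero => exact fun _ => hx
    | succ l ih =>
      exact fun hl => step _ _ (hU l (by omega)) (hU _ hl) (hp l hl) (ih (by omega))
  exact key N le_rfl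

lemma ConnIn.trans {U : Set (Pt d)} {x y z : Pt d} (h : ConnIn U x y) (h' : ConnIn U y z) :
    ConnIn U x z :=
  h'.induction (P := ConnIn U x) h fun _ _ _ hb hab ha => ha.tail hab hb

lemma ConnIn.symm {U : Set (Pt d)} {x y : Pt d} (h : ConnIn U x y) : ConnIn U y x :=
  h.induction (P := fun z => ConnIn U z x) (.refl h.left_mem) fun _ _ ha hb hab hax =>
    ((ConnIn.refl hb).tail (adj_comm.1 hab) ha).trans hax

lemma ConnIn.exists_exit {U P : Set (Pt d)} {x y : Pt d} (h : ConnIn U x y) (hx : x ∈ P)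
    (hy : y ∉ P) : ∃ a b, a ∈ U ∧ b ∈ U ∧ adj a b ∧ a ∈ P ∧ b ∉ P := by
  by_contra! hc
  exact hy (h.induction (P := (· ∈ P)) hx hc)

lemma connIn_uIcc (x y : Pt d) : ConnIn {z | ∀ k, z k ∈ Set.uIcc (x k) (y k)} x y := by
  induction hn : n1 x y using Nat.strong_induction_on generalizing x with
  | _ n ih =>
    by_cases hxy : x = y
    · subst hxy
      exact .refl fun k => by simp
    · obtain ⟨i, hi⟩ := Function.ne_iff.1 hxy
      obtain ⟨e, he, hlt, hmem⟩ : ∃ e : ℤ, e.natAbs = 1 ∧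
          (x i + e - y i).natAbs < (x i - y i).natAbs ∧ x i + e ∈ Set.uIcc (x i) (y i) := by
        rcases lt_or_gt_of_ne hi with h | h
        · exact ⟨1, rfl, by omega, by rw [Set.mem_uIcc]; omega⟩
        · exact ⟨-1, rfl, by omega, by rw [Set.mem_uIcc]; omega⟩
      have hcoord : ∀ k, (x + Pi.single i e : Pt d) k ∈ Set.uIcc (x k) (y k) := by
        intro k
        by_cases hk : k = i
        · subst hk; simpa using hmem
        · simp [hk]
      have hdec : n1 (x + Pi.single i e) y < n := by
        rw [← hn]
        refine Finset.sum_lt_sum (fun k _ => ?_) ⟨i, Finset.mem_univ i, by simpa using hlt⟩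
        by_cases hk : k = i
        · subst hk; simpa using hlt.le
        · simp [hk]
      have hx : x ∈ {z : Pt d | ∀ k, z k ∈ Set.uIcc (x k) (y k)} := fun k => Set.left_mem_uIcc
      refine ((ConnIn.refl hx).tail (adj_add_single x i he) hcoord).trans
        ((ih _ hdec _ rfl).mono fun z hz k => ?_)
      exact Set.uIcc_subset_uIcc (hcoord k) Set.right_mem_uIcc (hz k)

end Connectivity

section Fill

lemma notMem_fill_iff {A : Set (Pt d)} {z : Pt d} :
    z ∉ fill A ↔ ∃ S : Set (Pt d), z ∈ S ∧ S ⊆ Aᶜ ∧ ConnSet S ∧ S.Infinite := by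
  simp [fill]

lemma subset_fill (A : Set (Pt d)) : A ⊆ fill A :=
  fun _ hz _ hzS hS => absurd hz (hS hzS)

lemma mem_of_adj_notMem_fill {A : Set (Pt d)} {a b : Pt d} (hab : adj a b) (ha : a ∈ fill A)
    (hb : b ∉ fill A) : a ∈ A := by
  by_contra haA
  obtain ⟨S, hbS, hSA, hSc, hSi⟩ := notMem_fill_iff.1 hb
  have hconn : ∀ x ∈ insert a S, ConnIn (insert a S) x b := by
    rintro x (rfl | hx)
    · exact (ConnIn.refl (Set.mem_insert _ _)).tail hab (Set.mem_insert_of_mem _ hbS)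
    · exact (hSc x hx b hbS).mono (Set.subset_insert _ _)
  refine notMem_fill_iff.2 ⟨insert a S, Set.mem_insert _ _, ?_, fun x hx y hy =>
    (hconn x hx).trans (hconn y hy).symm, hSi.mono (Set.subset_insert _ _)⟩ ha
  exact Set.insert_subset haA hSA

/-- The points with some coordinate larger than `R` in absolute value. -/
def exterior (d R : ℕ) : Set (Pt d) := {x | ∃ k, R < (x k).natAbs}

lemma finite_compl_exterior (R : ℕ) : ((exterior d R)ᶜ).Finite := by
  refine (Set.finite_Icc (fun _ => -(R : ℤ)) (fun _ : Fin d => (R : ℤ))).subset fun x hx => ?_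
  simp only [exterior, Set.mem_compl_iff, Set.mem_ofPred_eq, not_exists, not_lt] at hx
  exact ⟨fun k => by have := hx k; dsimp only; omega, fun k => by have := hx k; dsimp only; omega⟩

lemma exists_mem_exterior_of_infinite {S : Set (Pt d)} (hS : S.Infinite) (R : ℕ) :
    ∃ x ∈ S, x ∈ exterior d R := by
  by_contra! hc
  exact hS ((finite_compl_exterior R).subset hc)

lemma infinite_exterior (hd : 2 ≤ d) (R : ℕ) : (exterior d R).Infinite := by
  have : Nonempty (Fin d) := ⟨⟨0, by omega⟩⟩
  simpa using (finite_compl_exterior (d := d) R).infinite_compl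

lemma connIn_exterior_of_ne {R : ℕ} {x y : Pt d} {i j : Fin d} (hij : i ≠ j)
    (hx : R < (x i).natAbs) (hy : R < (y j).natAbs) : ConnIn (exterior d R) x y := by
  have h1 : ConnIn (exterior d R) x (Function.update x j (y j)) := by
    refine (connIn_uIcc _ _).mono fun z hz => ⟨i, ?_⟩
    have := hz i
    rw [Function.update_of_ne hij, Set.uIcc_self] at this
    rwa [Set.mem_singleton_iff.1 this]
  have h2 : ConnIn (exterior d R) (Function.update x j (y j)) y := by
    refine (connIn_uIcc _ _).mono fun z hz => ⟨j, ?_⟩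
    have := hz j
    rw [Function.update_self, Set.uIcc_self] at this
    rwa [Set.mem_singleton_iff.1 this]
  exact h1.trans h2

lemma connSet_exterior (hd : 2 ≤ d) (R : ℕ) : ConnSet (exterior d R) := by
  rintro x ⟨i, hi⟩ y ⟨j, hj⟩
  by_cases hij : i = j
  · subst hij
    obtain ⟨k, hk⟩ : ∃ k, k ≠ i := by
      have : Nontrivial (Fin d) := Fin.nontrivial_iff_two_le.2 hd
      exact exists_ne i
    obtain ⟨w, hw⟩ : ∃ w : Pt d, R < (w k).natAbs := ⟨fun _ => R + 1, by dsimp only; omega⟩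
    exact (connIn_exterior_of_ne hk.symm hi hw).trans (connIn_exterior_of_ne hk hw hj)
  · exact connIn_exterior_of_ne hij hi hj

lemma exists_exterior_subset_compl {A : Set (Pt d)} (hA : A.Finite) :
    ∃ R, exterior d R ⊆ Aᶜ := by
  obtain ⟨R, hR⟩ := (hA.image fun x => ninf x 0).bddAbove
  refine ⟨R, fun x ⟨k, hk⟩ hxA => ?_⟩
  have h1 : ninf x 0 ≤ R := hR ⟨x, hxA, rfl⟩
  have h2 := natAbs_sub_le_ninf x 0 k
  simp only [Pi.zero_apply, sub_zero] at h2
  omega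

lemma exists_exterior_subset_compl_fill (hd : 2 ≤ d) {A : Set (Pt d)} (hA : A.Finite) :
    ∃ R, exterior d R ⊆ (fill A)ᶜ := by
  obtain ⟨R, hR⟩ := exists_exterior_subset_compl hA
  exact ⟨R, fun x hx =>
    notMem_fill_iff.2 ⟨_, hx, hR, connSet_exterior hd R, infinite_exterior hd R⟩⟩

lemma infinite_compl_fill (hd : 2 ≤ d) {A : Set (Pt d)} (hA : A.Finite) :
    ((fill A)ᶜ).Infinite := by
  obtain ⟨R, hR⟩ := exists_exterior_subset_compl_fill hd hA
  exact (infinite_exterior hd R).mono hR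

lemma exists_notMem_fill_of_infinite (hd : 2 ≤ d) {A S : Set (Pt d)} (hA : A.Finite)
    (hS : S.Infinite) : ∃ y ∈ S, y ∉ fill A := by
  obtain ⟨R, hR⟩ := exists_exterior_subset_compl_fill hd hA
  obtain ⟨y, hy, hyR⟩ := exists_mem_exterior_of_infinite hS R
  exact ⟨y, hy, hR hyR⟩

lemma connSet_compl_fill (hd : 2 ≤ d) {A : Set (Pt d)} (hA : A.Finite) :
    ConnSet (fill A)ᶜ := by
  obtain ⟨R, hR⟩ := exists_exterior_subset_compl_fill hd hA
  have key : ∀ x ∉ fill A, ∃ y ∈ exterior d R, ConnIn (fill A)ᶜ x y := by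
    intro x hx
    obtain ⟨S, hxS, hSA, hSc, hSi⟩ := notMem_fill_iff.1 hx
    obtain ⟨y, hyS, hyR⟩ := exists_mem_exterior_of_infinite hSi R
    exact ⟨y, hyR, (hSc x hxS y hyS).mono fun z hz => notMem_fill_iff.2 ⟨S, hz, hSA, hSc, hSi⟩⟩
  intro x hx y hy
  obtain ⟨x', hx', hxx'⟩ := key x hx
  obtain ⟨y', hy', hyy'⟩ := key y hy
  exact (hxx'.trans ((connSet_exterior hd R x' hx' y' hy').mono hR)).trans hyy'.symm

lemma fill_subset_fill (hd : 2 ≤ d) {A B : Set (Pt d)} (hB : B.Finite) (hAB : A ⊆ fill B) :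
    fill A ⊆ fill B := by
  intro z hz
  by_contra hzB
  exact notMem_fill_iff.2 ⟨_, hzB, Set.compl_subset_compl.2 hAB, connSet_compl_fill hd hB,
    infinite_compl_fill hd hB⟩ hz

lemma subset_fill_or_disjoint {A B : Set (Pt d)} (hA : ConnSet A) (hAB : Disjoint A B) :
    A ⊆ fill B ∨ Disjoint A (fill B) := by
  by_contra! hc
  obtain ⟨⟨x, hxA, hxB⟩, y, hyA, hyB⟩ :=
    And.imp Set.not_subset.1 Set.not_disjoint_iff.1 hc
  obtain ⟨a, b, haA, -, hab, haB, hbB⟩ := (hA y hyA x hxA).exists_exit hyB hxB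
  exact Set.disjoint_left.1 hAB haA (mem_of_adj_notMem_fill hab haB hbB)

lemma farInf.disjoint {A B : Set (Pt d)} (h : farInf A B) : Disjoint A B :=
  Set.disjoint_left.2 fun x hx hx' => by
    have := h x hx x hx'
    have h0 : ninf x x ≤ 0 := ninf_le_iff.2 (by simp)
    omega

lemma disjoint_fill_fill (hd : 2 ≤ d) {A B : Set (Pt d)} (hA : A.Finite)
    (hAB : Disjoint A (fill B)) (hBA : Disjoint B (fill A)) : Disjoint (fill A) (fill B) := by
  rw [Set.disjoint_left]
  intro x hxA hxB
  obtain ⟨y, -, hy⟩ := exists_notMem_fill_of_infinite hd hA (infinite_compl_fill hd hA)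
  obtain ⟨a, b, -, -, hab, ⟨haA, haB⟩, hb⟩ :=
    (connIn_uIcc x y).exists_exit (P := fill A ∩ fill B) ⟨hxA, hxB⟩ fun h => hy h.1
  rcases not_and_or.1 hb with hb | hb
  · exact Set.disjoint_left.1 hAB (mem_of_adj_notMem_fill hab haA hb) haB
  · exact Set.disjoint_left.1 hBA (mem_of_adj_notMem_fill hab haB hb) haA

lemma farInf_fill (hd : 2 ≤ d) {A B : Set (Pt d)} (hA : A.Finite) (hfar : farInf A B)
    (hAB : Disjoint A (fill B)) (hBA : Disjoint B (fill A)) : farInf (fill A) (fill B) := by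
  intro x hx y hy
  by_contra! hxy
  have hdisj := Set.disjoint_left.1 (disjoint_fill_fill hd hA hAB hBA)
  obtain ⟨a, b, ha, -, hab, haA, hbA⟩ := (connIn_uIcc x y).exists_exit hx fun h => hdisj h hy
  obtain ⟨a', b', ha', -, hab', haB, hbB⟩ := (connIn_uIcc x y).symm.exists_exit hy (hdisj hx)
  have h1 := hfar a (mem_of_adj_notMem_fill hab haA hbA) a' (mem_of_adj_notMem_fill hab' haB hbB)
  have h2 : ninf a a' ≤ 1 := ninf_le_iff.2 fun j => by
    have h3 := ha j
    have h4 := ha' j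
    have h5 := ninf_le_iff.1 hxy j
    rw [Set.mem_uIcc] at h3 h4
    omega
  omega

lemma fill_trichotomy (hd : 2 ≤ d) {A B : Set (Pt d)} (hA : A.Finite) (hB : B.Finite)
    (hAc : ConnSet A) (hBc : ConnSet B) (hfar : farInf A B) :
    fill A ⊆ fill B ∨ fill B ⊆ fill A ∨ farInf (fill A) (fill B) := by
  rcases subset_fill_or_disjoint hAc hfar.disjoint with h | hAB
  · exact .inl (fill_subset_fill hd hB h)
  rcases subset_fill_or_disjoint hBc hfar.disjoint.symm with h | hBA
  · exact .inr (.inl (fill_subset_fill hd hA h))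
  exact .inr (.inr (farInf_fill hd hA hfar hAB hBA))

end Fill

section Potential

/-- Discrete Poincaré lemma on `ℤ^d`: a closed lattice `1`-form is exact. -/
lemma exists_potential (g : Fin d → Pt d → ℤ)
    (hg : ∀ i j x, g i x + g j (x + Pi.single i 1) = g j x + g i (x + Pi.single j 1)) :
    ∃ f : Pt d → ℤ, ∀ i x, f (x + Pi.single i 1) = f x + g i x := by
  -- The shifts of the covering space `ℤ^d × ℤ` induced by `g` commute.
  let T : Fin d → Equiv.Perm (Pt d × ℤ) := fun i =>
    { toFun := fun p => (p.1 + Pi.single i 1, p.2 + g i p.1)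
      invFun := fun p => (p.1 - Pi.single i 1, p.2 - g i (p.1 - Pi.single i 1))
      left_inv := fun p => by simp
      right_inv := fun p => by simp }
  have hT : ∀ i p, T i p = (p.1 + Pi.single i 1, p.2 + g i p.1) := fun _ _ => rfl
  have hcomm : ∀ i j, Commute (T i) (T j) := fun i j => by
    ext1 p
    simp only [Equiv.Perm.mul_apply, hT, Prod.mk.injEq]
    exact ⟨add_right_comm _ _ _, by linarith [hg i j p.1]⟩
  let Φ := MonoidHom.noncommPiCoprod (fun i => zpowersHom (Equiv.Perm (Pt d × ℤ)) (T i))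
    fun i j _ x y => by
      simpa only [zpowersHom_apply] using ((hcomm i j).zpow_zpow _ _)
  let F : Pt d → Pt d × ℤ := fun x => Φ (fun j => Multiplicative.ofAdd (x j)) (0, 0)
  have hF : ∀ i x, F (x + Pi.single i 1) = T i (F x) := by
    intro i x
    have hsplit : (fun j => Multiplicative.ofAdd ((x + Pi.single i 1 : Pt d) j)) =
        Pi.mulSingle i (Multiplicative.ofAdd (1 : ℤ)) *
          fun j => Multiplicative.ofAdd (x j) := by
      funext j
      by_cases hj : j = i
      · subst hj
        simp [mul_comm]
      · simp [hj]
    have hΦ : Φ (Pi.mulSingle i (Multiplicative.ofAdd (1 : ℤ))) = T i := by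
      refine (MonoidHom.noncommPiCoprod_mulSingle _ i _).trans ?_
      rw [zpowersHom_apply, toAdd_ofAdd, zpow_one]
    simp only [F, hsplit, map_mul, hΦ, Equiv.Perm.mul_apply]
  have hF1 : ∀ x, (F x).1 = x := by
    intro x
    refine (connIn_uIcc 0 x).induction (P := fun z => (F z).1 = z) ?_ ?_
    · have : Φ (fun j => Multiplicative.ofAdd ((0 : Pt d) j)) = 1 := map_one Φ
      simp only [F, this, Equiv.Perm.one_apply]
    · intro a b _ _ hab ha
      obtain ⟨i, rfl | rfl⟩ := exists_single_of_adj hab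
      · rw [hF, hT, ha]
      · rw [hF, hT] at ha
        exact add_right_cancel ha
  exact ⟨fun x => (F x).2, fun i x => by simp only [hF, hT, hF1]⟩

end Potential

section Boundary

/-- If the boundary of a finite connected set is covered by sets which are pairwise at
`l∞`-distance larger than `1`, then a single one of them covers the exterior boundary. -/
lemma exists_outer_boundary_subset (hd : 2 ≤ d) {A : Set (Pt d)} (hAf : A.Finite)
    (hAc : ConnSet A) (hAne : A.Nonempty) {𝓕 : Set (Set (Pt d))}
    (hfar : 𝓕.Pairwise farInf) (hcov : bd A ⊆ ⋃₀ 𝓕) :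
    ∃ F ∈ 𝓕, bd A \ fill A ⊆ F := by
  classical
  have hbd : ∀ {u v}, u ∉ fill A → v ∈ fill A → adj u v → u ∈ bd A := fun hu hv huv =>
    ⟨fun h => hu (subset_fill A h), _, mem_of_adj_notMem_fill (adj_comm.1 huv) hv hu, huv⟩
  obtain ⟨x, hx⟩ := hAne
  obtain ⟨y, -, hy⟩ := exists_notMem_fill_of_infinite hd hAf (infinite_compl_fill hd hAf)
  obtain ⟨a₀, b₀, -, -, hab₀, ha₀, hb₀⟩ := (connIn_uIcc x y).exists_exit (subset_fill A hx) hy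
  obtain ⟨F, hF, hb₀F⟩ := hcov (hbd hb₀ ha₀ (adj_comm.1 hab₀))
  refine ⟨F, hF, fun b ⟨hb, hbfill⟩ => ?_⟩
  by_contra hbF
  obtain ⟨-, a, haA, hba⟩ := id hb
  have hlocal : ∀ u v u' v', u ∉ fill A → v ∈ fill A → adj u v → u' ∉ fill A → v' ∈ fill A →
      adj u' v' → ninf u u' ≤ 1 → u ∈ F → u' ∈ F := by
    intro u v u' v' hu hv huv hu' hv' huv' hclose huF
    obtain ⟨F', hF', huF'⟩ := hcov (hbd hu' hv' huv')
    by_cases hFF : F = F'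
    · rwa [hFF]
    · have := hfar hF hF' hFF u huF u' huF'
      omega
  let g : Pt d → Pt d → ℤ := fun u v =>
    (if v ∉ fill A ∧ u ∈ fill A ∧ v ∈ F then 1 else 0) -
      (if u ∉ fill A ∧ v ∈ fill A ∧ u ∈ F then 1 else 0)
  let p : Pt d → ℤ := fun u => if u ∈ fill A then 0 else 1
  -- On each unit cube, `g` is a multiple of the gradient of `p`.
  have hcube : ∀ x : Pt d, ∃ c : ℤ, ∀ u v : Pt d, (∀ l, x l ≤ u l ∧ u l ≤ x l + 1) →
      (∀ l, x l ≤ v l ∧ v l ≤ x l + 1) → adj u v → g u v = c * (p v - p u) := by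
    intro x
    by_cases h : ∃ u v : Pt d, (∀ l, x l ≤ u l ∧ u l ≤ x l + 1) ∧ u ∉ fill A ∧ v ∈ fill A ∧
        adj u v ∧ u ∈ F
    · obtain ⟨u₀, v₀, hu₀, hu₀A, hv₀A, huv₀, hu₀F⟩ := h
      have hin : ∀ u v : Pt d, (∀ l, x l ≤ u l ∧ u l ≤ x l + 1) → u ∉ fill A → v ∈ fill A →
          adj u v → u ∈ F := fun u v hu huA hvA huv =>
        hlocal u₀ v₀ u v hu₀A hv₀A huv₀ huA hvA huv
          (ninf_le_iff.2 fun l => by have := hu₀ l; have := hu l; omega) hu₀F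
      refine ⟨1, fun u v hu hv huv => ?_⟩
      by_cases huA : u ∈ fill A <;> by_cases hvA : v ∈ fill A
      · simp [g, p, huA, hvA]
      · simp [g, p, huA, hvA, hin v u hv hvA huA (adj_comm.1 huv)]
      · simp [g, p, huA, hvA, hin u v hu huA hvA huv]
      · simp [g, p, huA, hvA]
    · push Not at h
      refine ⟨0, fun u v hu hv huv => ?_⟩
      have h1 := h u v hu
      have h2 := h v u hv
      have huv' := adj_comm.1 huv
      simp only [g]
      rw [if_neg (by tauto), if_neg (by tauto)]
      simp
  obtain ⟨f, hf⟩ := exists_potential (fun i x => g x (x + Pi.single i 1)) (by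
    intro i j x
    by_cases hij : i = j
    · rw [hij]
    have hone : (1 : ℤ).natAbs = 1 := rfl
    have hm : ∀ k l : Fin d, x l ≤ (x + Pi.single k 1 : Pt d) l ∧
        (x + Pi.single k 1 : Pt d) l ≤ x l + 1 := fun k l => by
      by_cases h : l = k <;> simp [h]
    have hm' : ∀ l : Fin d, x l ≤ (x + Pi.single i 1 + Pi.single j 1 : Pt d) l ∧
        (x + Pi.single i 1 + Pi.single j 1 : Pt d) l ≤ x l + 1 := fun l => by
      simp only [Pi.add_apply, Pi.single_apply]
      split_ifs <;> omega
    have hx : ∀ l, x l ≤ x l ∧ x l ≤ x l + 1 := fun l => by omega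
    have e4 := adj_add_single (x + Pi.single j 1) i hone
    rw [add_right_comm x (Pi.single j 1)] at e4 ⊢
    obtain ⟨c, hc⟩ := hcube x
    rw [hc _ _ hx (hm i) (adj_add_single x i hone), hc _ _ hx (hm j) (adj_add_single x j hone),
      hc _ _ (hm i) hm' (adj_add_single _ j hone), hc _ _ (hm j) hm' e4]
    ring)
  have hstep : ∀ u v, adj u v → f v = f u + g u v := by
    intro u v huv
    obtain ⟨i, rfl | rfl⟩ := exists_single_of_adj huv
    · exact hf i u
    · have := hf i v
      simp only [g] at this ⊢
      omega
  have hconst : ∀ S : Set (Pt d), ConnSet S → (∀ u ∈ S, ∀ v ∈ S, g u v = 0) →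
      ∀ u ∈ S, ∀ v ∈ S, f v = f u := fun S hS h0 u hu v hv =>
    (hS u hu v hv).induction (P := fun w => f w = f u) rfl fun a b ha hb hab h => by
      rw [hstep a b hab, h0 a ha b hb, h, add_zero]
  have hA := hconst A hAc (fun u hu v hv => by
    simp [g, subset_fill A hu, subset_fill A hv]) a haA a₀ (mem_of_adj_notMem_fill hab₀ ha₀ hb₀)
  have hZ := hconst (fill A)ᶜ (connSet_compl_fill hd hAf) (fun u hu v hv => by
    have hu' : u ∉ fill A := hu
    have hv' : v ∉ fill A := hv
    simp [g, hu', hv']) b hbfill b₀ hb₀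
  have h1 := hstep a b (adj_comm.1 hba)
  have h2 := hstep a₀ b₀ hab₀
  simp only [g, hbfill, hbF, hb₀, hb₀F, ha₀, subset_fill A haA] at h1 h2
  simp at h1 h2
  omega

/-- If the boundary of a finite connected set is covered by pairwise `l∞`-distant filled sets,
then it is contained in one of them. -/
lemma exists_bd_subset (hd : 2 ≤ d) {A : Set (Pt d)} (hAf : A.Finite)
    (hAc : ConnSet A) (hAne : A.Nonempty) {𝓕 : Set (Set (Pt d))}
    (hfar : 𝓕.Pairwise farInf) (hfill : ∀ F ∈ 𝓕, ∃ V, F = fill V) (hcov : bd A ⊆ ⋃₀ 𝓕) :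
    ∃ F ∈ 𝓕, bd A ⊆ F := by
  obtain ⟨F, hF, hsub⟩ := exists_outer_boundary_subset hd hAf hAc hAne hfar hcov
  refine ⟨F, hF, fun p hp => ?_⟩
  obtain ⟨V, rfl⟩ := hfill F hF
  by_cases hpA : p ∈ fill A
  · by_contra hpV
    obtain ⟨S, hpS, hSV, hSc, hSi⟩ := notMem_fill_iff.1 hpV
    obtain ⟨y, hyS, hyA⟩ := exists_notMem_fill_of_infinite hd hAf hSi
    obtain ⟨a, b, -, hbS, hab, haA, hbA⟩ := (hSc p hpS y hyS).exists_exit hpA hyA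
    have hb : b ∈ bd A := ⟨fun h => hbA (subset_fill A h), a,
      mem_of_adj_notMem_fill hab haA hbA, adj_comm.1 hab⟩
    exact notMem_fill_iff.2 ⟨S, hbS, hSV, hSc, hSi⟩ (hsub ⟨hb, hbA⟩)
  · exact hsub ⟨hp, hpA⟩

end Boundary

section Boxes

lemma finite_boxCen (L₀ l : ℕ) : (boxCen L₀ l : Set (Pt d)).Finite :=
  (Set.finite_Icc (fun _ => -(((l : ℤ) - 1) * (L₀ : ℤ))) (fun _ : Fin d => (l : ℤ) * L₀)).subset
    fun _ hx => ⟨fun j => (hx j).1, fun j => (hx j).2.le⟩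

lemma nonempty_of_le_diam {L₀ : ℕ} (hL0 : 1 ≤ L₀) {A : Set (Pt d)}
    (hA : (L₀ : ℕ∞) ≤ 2 * diam A) : A.Nonempty := by
  by_contra hne
  rw [Set.not_nonempty_iff_eq_empty.1 hne] at hA
  have h0 : L₀ = 0 := by simpa [diam] using hA
  omega

/-- The neighborhood of radius `r` of the box `C²` enlarged by one. -/
def slab (L₀ : ℕ) (r : ℝ) : Set (Pt d) :=
  {x | ∀ j, -(L₀ : ℝ) - 1 - r ≤ x j ∧ (x j : ℝ) ≤ 2 * L₀ + r}

lemma slab_mono {L₀ : ℕ} {r s : ℝ} (h : r ≤ s) : (slab L₀ r : Set (Pt d)) ⊆ slab L₀ s :=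
  fun x hx j => by have := hx j; constructor <;> linarith [this.1, this.2]

lemma bounds_of_mem_bd {L₀ : ℕ} {A : Set (Pt d)} (hA : A ⊆ boxCen L₀ 2) {x : Pt d}
    (hx : x ∈ bd A) (j : Fin d) : -(L₀ : ℤ) - 1 ≤ x j ∧ x j ≤ 2 * L₀ := by
  obtain ⟨-, y, hy, hxy⟩ := hx
  have h1 := hA hy j
  have h2 : (x j - y j).natAbs ≤ 1 := hxy ▸ natAbs_sub_le_n1 x y j
  push_cast at h1
  omega

lemma slab_subset_boxCen {L₀ : ℕ} {r : ℝ} (hr : r < L₀) :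
    (slab L₀ r : Set (Pt d)) ⊆ boxCen L₀ 3 := by
  intro x hx j
  obtain ⟨h1, h2⟩ := hx j
  have h3 : -(2 * (L₀ : ℤ)) - 1 < x j := by
    have : -(2 * (L₀ : ℝ)) - 1 < x j := by linarith
    exact_mod_cast this
  have h4 : x j < 3 * (L₀ : ℤ) := by
    have : (x j : ℝ) < 3 * (L₀ : ℝ) := by linarith
    exact_mod_cast this
  push_cast
  omega

lemma mem_slab_of_ninf_le {L₀ : ℕ} {r h : ℝ} {x y : Pt d} (hy : y ∈ slab L₀ r)
    (hxy : (ninf x y : ℝ) ≤ h) : x ∈ slab L₀ (r + h) := by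
  intro j
  obtain ⟨h1, h2⟩ := hy j
  have h3 : |(x j : ℝ) - y j| ≤ h := by
    refine le_trans ?_ hxy
    have := natAbs_sub_le_ninf x y j
    have h4 : |x j - y j| ≤ (ninf x y : ℤ) := by rw [Int.abs_eq_natAbs]; exact_mod_cast this
    exact_mod_cast h4
  obtain ⟨h5, h6⟩ := abs_le.1 h3
  constructor <;> linarith

end Boxes

/-- a union of `G` fills of connected sets which individually do not
separate, are mutually `l∞`-far apart and are `(L₀/2G)`-avoidable in `C³`, does not
separate either. -/
theorem statement11 (d : ℕ) (hd : 2 ≤ d) (L₀ G : ℕ) (hL0 : 1 ≤ L₀) (hG : 1 ≤ G)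
    (U : Fin G → Set (Pt d)) (hUf : ∀ i, (U i).Finite) (hUc : ∀ i, ConnSet (U i))
    (hchi : ∀ i, ¬ chi0 L₀ (fill (U i)))
    (hfar : ∀ i j, i ≠ j → farInf (U i) (U j))
    (havoid : ∀ i, Avoidable ((L₀ : ℝ) / (2 * (G : ℝ))) (fill (U i)) (boxCen L₀ 3)) :
    ¬ chi0 L₀ (⋃ i, fill (U i)) := by
  rintro ⟨A₁, A₂, hA₁, hA₂, hc₁, hc₂, hd₁, hd₂, hsep⟩
  let 𝓕 : Set (Set (Pt d)) := {F | Maximal (· ∈ Set.range fun i => fill (U i)) F}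
  have hfarF : 𝓕.Pairwise farInf := by
    intro F hF F' hF' hne
    obtain ⟨i, rfl⟩ := hF.1
    obtain ⟨j, rfl⟩ := hF'.1
    have hij : i ≠ j := fun h => hne (by rw [h])
    rcases fill_trichotomy hd (hUf i) (hUf j) (hUc i) (hUc j) (hfar i j hij) with h | h | h
    · exact absurd (hF.eq_of_le hF'.1 h) hne
    · exact absurd (hF'.eq_of_le hF.1 h).symm hne
    · exact h
  have hUnion : (⋃ i, fill (U i)) ⊆ ⋃₀ 𝓕 := by
    refine Set.iUnion_subset fun i x hx => ?_
    obtain ⟨F, hle, hF⟩ := (Set.finite_range fun i => fill (U i)).exists_le_maximal ⟨i, rfl⟩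
    exact ⟨F, hF, hle hx⟩
  have hfillF : ∀ F ∈ 𝓕, ∃ i, F = fill (U i) := by
    intro F hF
    obtain ⟨i, rfl⟩ := hF.1
    exact ⟨i, rfl⟩
  have hend : ∀ A : Set (Pt d), A ⊆ boxCen L₀ 2 → ConnSet A → (L₀ : ℕ∞) ≤ 2 * diam A →
      (∀ i, ¬ bd A ⊆ fill (U i)) → ∃ x ∈ bd A, ∀ i, x ∉ fill (U i) := by
    intro A hA hAc hAd hAi
    by_contra! hc
    obtain ⟨F, hF, hsub⟩ := exists_bd_subset hd ((finite_boxCen L₀ 2).subset hA) hAc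
      (nonempty_of_le_diam hL0 hAd) hfarF
      (fun F hF => (hfillF F hF).imp' U fun _ => id)
      (fun x hx => hUnion (Set.mem_iUnion.2 (hc x hx)))
    obtain ⟨i, rfl⟩ := hfillF F hF
    exact hAi i hsub
  obtain ⟨x₁, hx₁, hx₁U⟩ := hend A₁ hA₁ hc₁ hd₁ fun i hi =>
    hchi i ⟨A₁, A₂, hA₁, hA₂, hc₁, hc₂, hd₁, hd₂, hsep.1,
      fun τ N _ _ h0 _ => ⟨0, Nat.zero_le _, hi h0⟩⟩
  obtain ⟨x₂, hx₂, hx₂U⟩ := hend A₂ hA₂ hc₂ hd₂ fun i hi =>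
    hchi i ⟨A₁, A₂, hA₁, hA₂, hc₁, hc₂, hd₁, hd₂, hsep.1,
      fun τ N _ _ _ hN => ⟨N, le_rfl, hi hN⟩⟩
  have hG0 : (0 : ℝ) < G := by exact_mod_cast hG
  have hL : (0 : ℝ) < L₀ := by exact_mod_cast hL0
  have hrad : ∀ n ≤ G, (n : ℝ) * ((L₀ : ℝ) / (2 * G)) < L₀ := by
    intro n hn
    calc (n : ℝ) * ((L₀ : ℝ) / (2 * G)) ≤ G * ((L₀ : ℝ) / (2 * G)) := by gcongr
      _ = L₀ / 2 := by field_simp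
      _ < L₀ := by linarith
  have hconn : ∀ n ≤ G, ConnIn (slab L₀ (n * ((L₀ : ℝ) / (2 * G))) ∩
      {z | ∀ i : Fin G, i < n → fill (U i) ∈ 𝓕 → z ∉ fill (U i)}) x₁ x₂ := by
    intro n
    induction n with
    | zero =>
      refine fun _ => (connIn_uIcc x₁ x₂).mono fun z hz =>
        ⟨fun j => ?_, fun i hi => absurd hi (Nat.not_lt_zero _)⟩
      have h1 := bounds_of_mem_bd hA₁ hx₁ j
      have h2 := bounds_of_mem_bd hA₂ hx₂ j
      have h3 := hz j
      rw [Set.mem_uIcc] at h3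
      have h4 : -(L₀ : ℤ) - 1 ≤ z j ∧ z j ≤ 2 * L₀ := by omega
      have h5 : (-(L₀ : ℝ) - 1 ≤ z j) ∧ ((z j : ℝ) ≤ 2 * L₀) := by exact_mod_cast h4
      simpa using h5
    | succ n ih =>
      intro hn
      obtain ⟨τ, N, hp, h0, hN, hτ⟩ := ih (by omega)
      by_cases hmax : fill (U ⟨n, hn⟩) ∈ 𝓕
      · obtain ⟨τ', N', hp', h0', hN', hav, hnear⟩ := havoid ⟨n, hn⟩ τ N hp
          (fun l hl => slab_subset_boxCen (hrad n (by omega)) (hτ l hl).1) (h0 ▸ hx₁U _) (hN ▸ hx₂U _)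
        refine ⟨τ', N', hp', h0'.trans h0, hN'.trans hN, fun l hl => ⟨?_, ?_⟩⟩
        · obtain ⟨k, hk, hclose⟩ := (hnear l hl).1
          have := mem_slab_of_ninf_le (hτ k hk).1 hclose
          push_cast
          rwa [add_one_mul]
        · intro i hi hiF
          by_cases hin : fill (U i) = fill (U ⟨n, hn⟩)
          · exact hin ▸ hav l hl
          rcases (hnear l hl).2 with ⟨k, hk, hkl⟩ | ⟨-, y, hy, hly⟩
          · have hine : (i : ℕ) ≠ n := fun h => hin (congrArg (fun j => fill (U j)) (Fin.ext h))
            exact hkl ▸ (hτ k hk).2 i (by omega) hiF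
          · intro hl
            have := hfarF hiF hmax hin _ hl y hy
            unfold adjStar at hly
            omega
      · refine ⟨τ, N, hp, h0, hN, fun l hl => ⟨?_, ?_⟩⟩
        · refine slab_mono ?_ (hτ l hl).1
          push_cast
          gcongr
          linarith
        · intro i hi hiF
          have hine : (i : ℕ) ≠ n := fun h => hmax ((Fin.ext h : i = ⟨n, hn⟩) ▸ hiF)
          exact (hτ l hl).2 i (by omega) hiF
  obtain ⟨τ, N, hp, h0, hN, hτ⟩ := hconn G le_rfl
  obtain ⟨l, hl, hmem⟩ := hsep.2 τ N hp (fun l hl => slab_subset_boxCen (hrad G le_rfl) (hτ l hl).1)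
    (h0 ▸ hx₁) (hN ▸ hx₂)
  obtain ⟨F, hF, hlF⟩ := hUnion hmem
  obtain ⟨i, rfl⟩ := hfillF F hF
  exact (hτ l hl).2 i i.2 hF hlF

end RI
end

section
/- Let w : ℤ → ℤ^d satisfy ‖w(l+1)−w(l)‖₁ = 1 for all l ∈ ℤ, let k be a cut-time of w, and set e = w(k+1) − w(k). Then the set Ring = {y ∈ ℤ^d : ‖y − w(k)‖_∞ = 1 and ⟨y − w(k), e⟩ = 0} is disjoint from {w(l) : l ∈ ℤ}. -/
namespace RI

variable {d : ℕ}

lemma ninf_le_one_iff (x y : Pt d) : ninf x y ≤ 1 ↔ ∀ j, (x j - y j).natAbs ≤ 1 := by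
  simp [ninf]

/-- Nearest neighbors differ by one in exactly one coordinate. -/
lemma adj.exists_coord {x y : Pt d} (h : adj x y) :
    ∃ i, (x i - y i).natAbs = 1 ∧ ∀ j, j ≠ i → x j = y j := by
  obtain ⟨i, -, hi⟩ : ∃ i ∈ Finset.univ, (x i - y i).natAbs ≠ 0 :=
    Finset.exists_ne_zero_of_sum_ne_zero (by rw [adj, n1] at h; omega)
  have hsum : (x i - y i).natAbs + ∑ j ∈ Finset.univ.erase i, (x j - y j).natAbs = 1 :=
    (Finset.add_sum_erase _ _ (Finset.mem_univ i)).trans h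
  refine ⟨i, by omega, fun j hj => ?_⟩
  have hle : (x j - y j).natAbs ≤ ∑ j ∈ Finset.univ.erase i, (x j - y j).natAbs :=
    Finset.single_le_sum (f := fun j => (x j - y j).natAbs) (fun _ _ => Nat.zero_le _)
      (Finset.mem_erase.2 ⟨hj, Finset.mem_univ j⟩)
  omega

/-- the ring of `*`-neighbors of `w(k)` perpendicular to
`e = w(k+1) - w(k)` is disjoint from the whole trajectory. -/
theorem statement13 (d : ℕ) (w : ℤ → Pt d)
    (hw : ∀ l : ℤ, adj (w l) (w (l + 1))) (k : ℤ) (hk : CutTime w k)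
    (y : Pt d) (h1 : ninf y (w k) = 1)
    (h2 : ∑ j, (y j - w k j) * (w (k + 1) j - w k j) = 0) :
    ∀ l : ℤ, y ≠ w l := by
  rintro l rfl
  obtain ⟨i, hi, hi'⟩ := (hw k).exists_coord
  have hprev := hw (k - 1)
  rw [sub_add_cancel] at hprev
  obtain ⟨i', hi₂, hi₂'⟩ := hprev.exists_coord
  have hyi : w l i = w k i := by
    rw [Finset.sum_eq_single i (fun j _ hj => by rw [hi' j hj]; ring) (by simp)] at h2
    rcases mul_eq_zero.1 h2 with h | h <;> omega
  have hring := (ninf_le_one_iff _ _).1 h1.le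
  have hii : i' = i := by
    by_contra hne
    refine (hk (k - 1) (by omega) (k + 1) (by omega)).not_ge ((ninf_le_one_iff _ _).2 fun j => ?_)
    by_cases hj : j = i
    · subst hj
      rw [hi₂' j (Ne.symm hne)]
      exact hi.le
    · rw [← hi' j hj]
      by_cases hj' : j = i'
      · rw [hj']
        exact hi₂.le
      · simp [hi₂' j hj']
  subst hii
  rcases lt_trichotomy l k with hl | rfl | hl
  · refine (hk l hl (k + 1) (by omega)).not_ge ((ninf_le_one_iff _ _).2 fun j => ?_)
    by_cases hj : j = i'
    · rw [hj, hyi]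
      exact hi.le
    · rw [← hi' j hj]
      exact hring j
  · have h0 : ninf (w l) (w l) ≤ 0 := Finset.sup_le fun j _ => by simp
    omega
  · refine (hk (k - 1) (by omega) l hl).not_ge ((ninf_le_one_iff _ _).2 fun j => ?_)
    by_cases hj : j = i'
    · rw [hj, hyi]
      exact hi₂.le
    · rw [hi₂' j hj]
      have := hring j
      omega

end RI
end
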